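/- arXiv:2005.11781 — 2 statements merged into one kernel-verified Lean document; each statement's English description precedes it below -/
import Mathlib

section
/- Suppose there exists a measurable weight $\gamma: \mathbb{R}^n \to (0,\infty)$, locally bounded away from $0$ and $\infty$, and a constant $C > 0$ such that $\int_{\mathbb{R}^n} \gamma |\varphi|^p\,dx \le C \int_{\mathbb{R}^n} |\nabla\varphi|^p\,dx$ for all $\varphi \in C_0^\infty(\mathbb{R}^n)$. Then every compact set $K$ of positive Lebesgue measure has $\operatorname{cap}_p(K,\mathbb{R}^n) > 0$. -/
open MeasureTheory

noncomputable def pCap (n : ℕ) (p : ℝ) (K ω : Set (EuclideanSpace ℝ (Fin n))) : ℝ :=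
  sInf {c : ℝ | ∃ φ : EuclideanSpace ℝ (Fin n) → ℝ, ContDiff ℝ (⊤ : ℕ∞) φ ∧ HasCompactSupport φ ∧
    tsupport φ ⊆ ω ∧ (∃ U : Set (EuclideanSpace ℝ (Fin n)), IsOpen U ∧ K ⊆ U ∧ Set.EqOn φ 1 U) ∧
    c = ∫ x in ω, ‖fderiv ℝ φ x‖ ^ p}

/-- A measurable function that is bounded on compact sets, multiplied by a power of a
compactly supported continuous function, is integrable. -/
theorem integrable_mul_abs_rpow_of_hasCompactSupport {E : Type*} [TopologicalSpace E]
    [MeasurableSpace E] [BorelSpace E] {μ : Measure E} [IsFiniteMeasureOnCompacts μ]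
    {p : ℝ} (hp : 0 < p) {γ φ : E → ℝ} (hγ : Measurable γ)
    (hγloc : ∀ K : Set E, IsCompact K → ∃ c, ∀ x ∈ K, |γ x| ≤ c)
    (hφ : Continuous φ) (hφc : HasCompactSupport φ) :
    Integrable (fun x => γ x * |φ x| ^ p) μ := by
  obtain ⟨c, hc⟩ := hγloc (tsupport φ) hφc
  obtain ⟨M, hM⟩ := hφc.exists_bound_of_continuous hφ
  have hs : Function.support (fun x => γ x * |φ x| ^ p) ⊆ tsupport φ := fun x hx => by
    by_contra h
    exact hx (by simp [image_eq_zero_of_notMem_tsupport h, Real.zero_rpow hp.ne'])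
  rw [← integrableOn_iff_integrable_of_support_subset hs]
  refine Measure.integrableOn_of_bounded (M := c * M ^ p) hφc.measure_lt_top.ne ?_ ?_
  · exact (hγ.mul (hφ.measurable.abs.pow_const p)).aestronglyMeasurable
  · refine ae_restrict_of_forall_mem (isClosed_tsupport φ).measurableSet fun x hx => ?_
    rw [norm_mul, Real.norm_eq_abs, Real.norm_of_nonneg (by positivity)]
    have h := hM x
    rw [Real.norm_eq_abs] at h
    have := (abs_nonneg _).trans (hc x hx)
    gcongr
    exact hc x hx

/-- A compact set in a space with smooth bump functions has a smooth compactly supported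
function equal to `1` near it. -/
theorem IsCompact.exists_contDiff_hasCompactSupport_eqOn_one {E : Type*} [NormedAddCommGroup E]
    [NormedSpace ℝ E] [FiniteDimensional ℝ E] [HasContDiffBump E] {K : Set E}
    (hK : IsCompact K) :
    ∃ φ : E → ℝ, ContDiff ℝ (⊤ : ℕ∞) φ ∧ HasCompactSupport φ ∧
      ∃ U : Set E, IsOpen U ∧ K ⊆ U ∧ Set.EqOn φ 1 U := by
  obtain ⟨R, hR, hKR⟩ := hK.isBounded.subset_ball_lt 0 (0 : E)
  let f : ContDiffBump (0 : E) := ⟨R, R + 1, hR, by linarith⟩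
  exact ⟨f, f.contDiff, f.hasCompactSupport, Metric.ball 0 R, Metric.isOpen_ball, hKR,
    fun x hx => f.one_of_mem_closedBall (Metric.ball_subset_closedBall hx)⟩

theorem hardy_implies_hyperbolic (n : ℕ) (p C : ℝ) (hp : 1 < p) (hC : 0 < C)
    (γ : EuclideanSpace ℝ (Fin n) → ℝ) (hγm : Measurable γ) (hγ0 : ∀ x, 0 < γ x)
    (hγloc : ∀ K : Set (EuclideanSpace ℝ (Fin n)), IsCompact K →
      ∃ c₁ c₂ : ℝ, 0 < c₁ ∧ ∀ x ∈ K, c₁ ≤ γ x ∧ γ x ≤ c₂)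
    (hHardy : ∀ φ : EuclideanSpace ℝ (Fin n) → ℝ, ContDiff ℝ (⊤ : ℕ∞) φ → HasCompactSupport φ →
      ∫ x, γ x * |φ x| ^ p ≤ C * ∫ x, ‖fderiv ℝ φ x‖ ^ p) :
    ∀ K : Set (EuclideanSpace ℝ (Fin n)), IsCompact K → 0 < volume K →
      0 < pCap n p K Set.univ := by
  intro K hK hKpos
  obtain ⟨c₁, _, hc₁, hγK⟩ := hγloc K hK
  have hvol : 0 < volume.real K := ENNReal.toReal_pos hKpos.ne' hK.measure_lt_top.ne
  refine lt_of_lt_of_le (b := c₁ * volume.real K / C) (by positivity) (le_csInf ?_ ?_)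
  · obtain ⟨φ, hφ, hφc, hU⟩ := hK.exists_contDiff_hasCompactSupport_eqOn_one
    exact ⟨_, φ, hφ, hφc, Set.subset_univ _, hU, rfl⟩
  · rintro _ ⟨φ, hφ, hφc, -, ⟨U, -, hKU, hφU⟩, rfl⟩
    rw [setIntegral_univ, div_le_iff₀' hC]
    have hint : Integrable (fun x => γ x * |φ x| ^ p) volume := by
      refine integrable_mul_abs_rpow_of_hasCompactSupport (by linarith) hγm (fun L hL => ?_)
        hφ.continuous hφc
      obtain ⟨_, c₂, -, h⟩ := hγloc L hL
      exact ⟨c₂, fun x hx => (abs_of_pos (hγ0 x)).trans_le (h x hx).2⟩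
    calc c₁ * volume.real K ≤ ∫ x in K, γ x * |φ x| ^ p := by
          refine setIntegral_ge_of_const_le_real hK.measurableSet hK.measure_lt_top.ne
            (fun x hx => ?_) hint.integrableOn
          simpa [hφU (hKU hx)] using (hγK x hx).1
      _ ≤ ∫ x, γ x * |φ x| ^ p :=
          setIntegral_le_integral hint (.of_forall fun x => by have := hγ0 x; positivity)
      _ ≤ _ := hHardy φ hφ hφc
end

section
/- Let $M = \{(x', x_n) \in \mathbb{R}^{n-1} \times \mathbb{R} : |x'| \le x_n^\lambda,\ x_n \ge 1\}$ with $n \ge 2$, $\lambda \ge 0$, and $p > 1$. If $n \le p$ or $\lambda \le (p-1)/(n-1)$, then for every $r \ge 1$, $\inf\left\{\int_M |\nabla\varphi|^p dx : \varphi \in C_0^\infty(\mathbb{R}^n),\ \varphi = 1 \text{ on } M \cap \overline{B}_r\right\} = 0$, i.e. the paraboloid-type region $M$ is $p$-parabolic. -/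
open MeasureTheory

/-- Volume bound for subsets of a coordinate box in Euclidean space. -/
lemma volume_real_le_prod_of_abs_le {m : ℕ} (S : Set (EuclideanSpace ℝ (Fin m))) (a : Fin m → ℝ)
    (ha : ∀ i, 0 ≤ a i) (hS : ∀ x ∈ S, ∀ i, |x i| ≤ a i) :
    volume.real S ≤ ∏ i, (2 * a i) := by
  have hmp := EuclideanSpace.volume_preserving_symm_measurableEquiv_toLp (Fin m)
  have hsub : S ⊆ (MeasurableEquiv.toLp 2 (Fin m → ℝ)).symm ⁻¹' Set.Icc (-a) a := fun x hx =>
    ⟨fun i => (abs_le.1 (hS x hx i)).1, fun i => (abs_le.1 (hS x hx i)).2⟩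
  have hvol := hmp.measure_preimage (measurableSet_Icc (a := -a) (b := a)).nullMeasurableSet
  have hle : -a ≤ a := fun i => by simpa using (ha i)
  calc volume.real S
      ≤ volume.real ((MeasurableEquiv.toLp 2 (Fin m → ℝ)).symm ⁻¹' Set.Icc (-a) a) := by
        refine measureReal_mono hsub ?_
        rw [hvol, Real.volume_Icc_pi]
        exact (ENNReal.prod_lt_top fun i _ => ENNReal.ofReal_lt_top).ne
    _ = ∏ i, (2 * a i) := by
        rw [measureReal_def, hvol, Real.volume_Icc_pi_toReal hle]
        exact Finset.prod_congr rfl fun i _ => by simp [two_mul]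

/-- A smooth radial cutoff equal to one on the unit ball, whose derivative is bounded and lives in
the shell `1 ≤ ‖x‖ ≤ 3 / 2`. -/
lemma exists_smooth_cutoff (E : Type*) [NormedAddCommGroup E] [InnerProductSpace ℝ E]
    [FiniteDimensional ℝ E] :
    ∃ η : E → ℝ, ContDiff ℝ (⊤ : ℕ∞) η ∧ HasCompactSupport η ∧
      (∀ x, ‖x‖ ≤ 1 → η x = 1) ∧
      (∀ x, fderiv ℝ η x ≠ 0 → 1 ≤ ‖x‖ ∧ ‖x‖ ≤ 3 / 2) ∧
      ∃ C : ℝ, 0 ≤ C ∧ ∀ x, ‖fderiv ℝ η x‖ ≤ C := by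
  let b : ContDiffBump (0 : E) := ⟨1, 3 / 2, by norm_num, by norm_num⟩
  have hb : ContDiff ℝ (⊤ : ℕ∞) b := b.contDiff
  refine ⟨b, hb, b.hasCompactSupport, fun x hx => b.one_of_mem_closedBall (by simpa using hx),
    fun x hx => ⟨?_, ?_⟩, ?_⟩
  · by_contra! h
    refine hx ?_
    have hev : (b : E → ℝ) =ᶠ[nhds x] 1 :=
      b.eventuallyEq_one_of_mem_ball (by simpa using h)
    rw [hev.fderiv_eq]
    exact fderiv_const_apply (1 : ℝ)
  · have := support_fderiv_subset ℝ (f := (b : E → ℝ)) hx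
    rw [b.tsupport_eq] at this
    simpa using this
  · obtain ⟨C, hC⟩ := (b.hasCompactSupport.fderiv (𝕜 := ℝ)).exists_bound_of_continuous
      (hb.continuous_fderiv (by simp))
    exact ⟨C, (norm_nonneg _).trans (hC 0), hC⟩

/-- If at most one summand is nonzero, the power of the norm of a sum is at most the sum of any
nonnegative bounds on the powers of the nonzero terms. -/
lemma norm_sum_rpow_le_of_unique {ι F : Type*} [NormedAddCommGroup F] (s : Finset ι) (f : ι → F)
    (g : ι → ℝ) {p : ℝ} (hp : 0 < p) (hg : ∀ i ∈ s, 0 ≤ g i)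
    (hfg : ∀ i ∈ s, f i ≠ 0 → ‖f i‖ ^ p ≤ g i)
    (huniq : ∀ i ∈ s, ∀ j ∈ s, f i ≠ 0 → f j ≠ 0 → i = j) :
    ‖∑ i ∈ s, f i‖ ^ p ≤ ∑ i ∈ s, g i := by
  by_cases h : ∃ i ∈ s, f i ≠ 0
  · obtain ⟨i, hi, hfi⟩ := h
    rw [Finset.sum_eq_single_of_mem i hi fun j hj hji => by
      by_contra hfj
      exact hji (huniq j hj i hi hfj hfi)]
    exact (hfg i hi hfi).trans (Finset.single_le_sum hg hi)
  · push Not at h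
    rw [Finset.sum_eq_zero h, norm_zero, Real.zero_rpow hp.ne']
    exact Finset.sum_nonneg hg

/-- A set whose intersection with the ball of radius `t` has volume `O(t ^ p)` is `p`-parabolic. -/
lemma exists_cutoff_integral_lt_of_volume_le {E : Type*} [NormedAddCommGroup E]
    [InnerProductSpace ℝ E] [FiniteDimensional ℝ E] [MeasureSpace E] [BorelSpace E]
    [IsFiniteMeasureOnCompacts (volume : Measure E)] (M : Set E) {p K : ℝ} (hp : 1 < p)
    (hvol : ∀ t : ℝ, 1 ≤ t → volume.real (M ∩ Metric.closedBall 0 t) ≤ K * t ^ p)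
    {r : ℝ} (hr : 1 ≤ r) {ε : ℝ} (hε : 0 < ε) :
    ∃ φ : E → ℝ, ContDiff ℝ (⊤ : ℕ∞) φ ∧ HasCompactSupport φ ∧
      Set.EqOn φ 1 (M ∩ Metric.closedBall 0 r) ∧ ∫ x in M, ‖fderiv ℝ φ x‖ ^ p < ε := by
  obtain ⟨η, hη, hηc, hη1, hηd, C, hC0, hC⟩ := exists_smooth_cutoff E
  have hp0 : 0 < p := one_pos.trans hp
  obtain ⟨N, hN, hNε⟩ : ∃ N : ℕ, 0 < N ∧ C ^ p * K * 2 ^ p * (N : ℝ) ^ (-(p - 1)) < ε := by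
    have h := ((tendsto_rpow_neg_atTop (sub_pos.2 hp)).comp
      tendsto_natCast_atTop_atTop).const_mul (C ^ p * K * 2 ^ p)
    rw [mul_zero] at h
    exact ((Filter.eventually_gt_atTop 0).and (h.eventually_lt_const hε)).exists
  have hN' : (0 : ℝ) < N := by exact_mod_cast hN
  let ρ : ℕ → ℝ := fun k => 2 ^ k * r
  have hρ : ∀ k, 1 ≤ ρ k := fun k => one_le_mul_of_one_le_of_one_le (one_le_pow₀ one_le_two) hr
  have hρ0 : ∀ k, 0 < ρ k := fun k => one_pos.trans_le (hρ k)
  let ψ : ℕ → E → ℝ := fun k x => (N : ℝ)⁻¹ * η ((ρ k)⁻¹ • x)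
  have hψ : ∀ k, ContDiff ℝ (⊤ : ℕ∞) (ψ k) := fun k =>
    contDiff_const.mul (hη.comp (contDiff_const_smul _))
  have hψd : ∀ k x, fderiv ℝ (ψ k) x = ((N : ℝ)⁻¹ * (ρ k)⁻¹) • fderiv ℝ η ((ρ k)⁻¹ • x) := by
    intro k x
    have h1 : HasFDerivAt (fun y : E => η ((ρ k)⁻¹ • y))
        ((fderiv ℝ η ((ρ k)⁻¹ • x)).comp ((ρ k)⁻¹ • ContinuousLinearMap.id ℝ E)) x :=
      ((hη.differentiable (by simp)) _).hasFDerivAt.comp x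
        ((hasFDerivAt_id x).const_smul (ρ k)⁻¹)
    rw [(h1.const_mul (N : ℝ)⁻¹).fderiv]
    ext v
    simp [mul_assoc]
  have hnorm : ∀ k (x : E), ‖(ρ k)⁻¹ • x‖ = ‖x‖ / ρ k := fun k x => by
    rw [norm_smul, norm_inv, Real.norm_of_nonneg (hρ0 k).le, div_eq_inv_mul]
  have hshell : ∀ k x, fderiv ℝ (ψ k) x ≠ 0 → ρ k ≤ ‖x‖ ∧ ‖x‖ ≤ 3 / 2 * ρ k := by
    intro k x h
    have h' := hηd ((ρ k)⁻¹ • x) fun h0 => h (by rw [hψd, h0, smul_zero])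
    rwa [hnorm, one_le_div (hρ0 k), div_le_iff₀ (hρ0 k)] at h'
  have hlt : ∀ i j x, i < j → fderiv ℝ (ψ i) x ≠ 0 → fderiv ℝ (ψ j) x ≠ 0 → False := by
    intro i j x hij hi hj
    have h1 : 2 * ρ i ≤ ρ j := by
      have : (2 : ℝ) ^ (i + 1) ≤ 2 ^ j := pow_le_pow_right₀ one_le_two hij
      calc 2 * ρ i = 2 ^ (i + 1) * r := by simp only [ρ]; ring
        _ ≤ 2 ^ j * r := by gcongr
    linarith [(hshell i x hi).2, (hshell j x hj).1, hρ0 i]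
  let c : ℕ → ℝ := fun k => ((N : ℝ)⁻¹ * (ρ k)⁻¹ * C) ^ p
  have hc : ∀ k, 0 ≤ c k := fun k => by have := hρ0 k; positivity
  let g : ℕ → E → ℝ := fun k => (Metric.closedBall (0 : E) (2 * ρ k)).indicator fun _ => c k
  have hg : ∀ k x, 0 ≤ g k x := fun k x => Set.indicator_nonneg (fun _ _ => hc k) x
  have hfin : ∀ t, (volume.restrict M) (Metric.closedBall (0 : E) t) ≠ ⊤ := fun t =>
    ((Measure.restrict_apply_le _ _).trans_lt
      (isCompact_closedBall (0 : E) t).measure_lt_top).ne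
  have hgi : ∀ k, Integrable (g k) (volume.restrict M) := fun k =>
    (integrable_indicator_iff measurableSet_closedBall).2 (integrableOn_const (hfin _))
  have hgint : ∀ k, ∫ x in M, g k x ≤ C ^ p * K * 2 ^ p * (N : ℝ) ^ (-p) := by
    intro k
    have h2 : 0 < ρ k := hρ0 k
    rw [integral_indicator_const _ measurableSet_closedBall, smul_eq_mul,
      measureReal_restrict_apply measurableSet_closedBall, Set.inter_comm]
    calc volume.real (M ∩ Metric.closedBall 0 (2 * ρ k)) * c k
        ≤ K * (2 * ρ k) ^ p * c k :=
          mul_le_mul_of_nonneg_right (hvol _ (by linarith [hρ k])) (hc k)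
      _ = C ^ p * K * 2 ^ p * (N : ℝ) ^ (-p) := by
          have : (ρ k) ^ p ≠ 0 := (Real.rpow_pos_of_pos h2 p).ne'
          simp only [c]
          rw [Real.mul_rpow zero_le_two h2.le, Real.mul_rpow (by positivity) hC0,
            Real.mul_rpow (inv_nonneg.2 hN'.le) (inv_nonneg.2 h2.le), Real.inv_rpow hN'.le,
            Real.inv_rpow h2.le,
            Real.rpow_neg hN'.le]
          field_simp
  refine ⟨fun x => ∑ k ∈ Finset.range N, ψ k x, ContDiff.sum fun k _ => hψ k, ?_, ?_, ?_⟩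
  · have hψc : ∀ k, HasCompactSupport (ψ k) := fun k =>
      (hηc.comp_smul (inv_ne_zero (hρ0 k).ne')).mul_left
    refine HasCompactSupport.intro
      ((Finset.range N).isCompact_biUnion fun k _ => (hψc k).isCompact) fun x hx => ?_
    refine Finset.sum_eq_zero fun k hk => image_eq_zero_of_notMem_tsupport fun hxk => hx ?_
    exact Set.mem_biUnion hk hxk
  · rintro x ⟨-, hx⟩
    have hx' : ‖x‖ ≤ r := by simpa using hx
    have h1 : ∀ k, η ((ρ k)⁻¹ • x) = 1 := fun k => hη1 _ <| by
      rw [hnorm, div_le_one (hρ0 k)]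
      exact hx'.trans (le_mul_of_one_le_left (by linarith) (one_le_pow₀ one_le_two))
    simp [ψ, h1, hN'.ne']
  · calc ∫ x in M, ‖fderiv ℝ (fun x => ∑ k ∈ Finset.range N, ψ k x) x‖ ^ p
        ≤ ∫ x in M, ∑ k ∈ Finset.range N, g k x := by
          refine integral_mono_of_nonneg (.of_forall fun x => by positivity)
            (integrable_finsetSum _ fun k _ => hgi k) (.of_forall fun x => ?_)
          dsimp only
          rw [fderiv_fun_sum fun k _ => (hψ k).differentiable (by simp) x]
          refine norm_sum_rpow_le_of_unique _ _ _ hp0 (fun k _ => hg k x) (fun k _ hk => ?_)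
            fun i _ j _ hi hj => ?_
          · have hmem : x ∈ Metric.closedBall (0 : E) (2 * ρ k) := by
              rw [mem_closedBall_zero_iff]
              linarith [(hshell k x hk).2, hρ0 k]
            have h2 := hρ0 k
            simp only [g, Set.indicator_of_mem hmem, c]
            rw [hψd, norm_smul, Real.norm_of_nonneg (by positivity)]
            have := hC ((ρ k)⁻¹ • x)
            gcongr
          · rcases lt_trichotomy i j with h | h | h
            · exact (hlt i j x h hi hj).elim
            · exact h
            · exact (hlt j i x h hj hi).elim
      _ = ∑ k ∈ Finset.range N, ∫ x in M, g k x := integral_finsetSum _ fun k _ => hgi k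
      _ ≤ ∑ k ∈ Finset.range N, C ^ p * K * 2 ^ p * (N : ℝ) ^ (-p) :=
          Finset.sum_le_sum fun k _ => hgint k
      _ = C ^ p * K * 2 ^ p * (N : ℝ) ^ (-(p - 1)) := by
          rw [Finset.sum_const, Finset.card_range, nsmul_eq_mul,
            show -(p - 1) = -p + 1 by ring, Real.rpow_add hN', Real.rpow_one]
          ring
      _ < ε := hNε

theorem paraboloid_region_parabolic (m : ℕ) (hm : 2 ≤ m) (p lam : ℝ) (hp : 1 < p)
    (hlam : 0 ≤ lam)
    (hpar : (m : ℝ) ≤ p ∨ lam ≤ (p - 1) / ((m : ℝ) - 1))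
    (M : Set (EuclideanSpace ℝ (Fin m)))
    (hM : M = {x : EuclideanSpace ℝ (Fin m) |
      Real.sqrt (∑ i ∈ Finset.univ.filter (fun i : Fin m => (i : ℕ) < m - 1), x i ^ 2) ≤
        x ⟨m - 1, by omega⟩ ^ lam ∧ 1 ≤ x ⟨m - 1, by omega⟩}) :
    ∀ r : ℝ, 1 ≤ r → ∀ ε : ℝ, 0 < ε →
      ∃ φ : EuclideanSpace ℝ (Fin m) → ℝ, ContDiff ℝ (⊤ : ℕ∞) φ ∧ HasCompactSupport φ ∧
        Set.EqOn φ 1 (M ∩ Metric.closedBall 0 r) ∧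
        ∫ x in M, ‖fderiv ℝ φ x‖ ^ p < ε := by
  intro r hr ε hε
  refine exists_cutoff_integral_lt_of_volume_le (K := 2 ^ m) M hp (fun t ht => ?_) hr hε
  have ht0 : 0 < t := one_pos.trans_le ht
  have hcoord : ∀ x ∈ M ∩ Metric.closedBall 0 t, ∀ i, |x i| ≤ t := fun x hx i =>
    (PiLp.norm_apply_le x i).trans (by simpa using hx.2)
  rcases hpar with h | h
  · calc volume.real (M ∩ Metric.closedBall 0 t)
        ≤ ∏ _i : Fin m, (2 * t) :=
          volume_real_le_prod_of_abs_le _ (fun _ => t) (fun _ => ht0.le) hcoord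
      _ = 2 ^ m * t ^ (m : ℝ) := by simp [mul_pow]
      _ ≤ 2 ^ m * t ^ p := by gcongr
  · obtain ⟨n, rfl⟩ : ∃ n, m = n + 1 := ⟨m - 1, by omega⟩
    have hn : (0 : ℝ) < n := by exact_mod_cast (by omega : 0 < n)
    have hexp : lam * n + 1 ≤ p := by
      rw [Nat.cast_add, Nat.cast_one, add_sub_cancel_right, le_div_iff₀ hn] at h
      linarith
    let a : Fin (n + 1) → ℝ := Fin.snoc (fun _ : Fin n => t ^ lam) t
    have hbox : ∀ x ∈ M ∩ Metric.closedBall 0 t, ∀ i, |x i| ≤ a i := by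
      intro x hx i
      refine Fin.lastCases ?_ (fun j => ?_) i
      · simpa [a] using hcoord x hx (Fin.last n)
      · have hxM := hx.1
        rw [hM] at hxM
        obtain ⟨h1, h2⟩ := hxM
        simp only [a, Fin.snoc_castSucc]
        calc |x j.castSucc| = Real.sqrt (x j.castSucc ^ 2) := (Real.sqrt_sq_eq_abs _).symm
          _ ≤ _ := Real.sqrt_le_sqrt (Finset.single_le_sum (f := fun i => x i ^ 2)
              (fun i _ => sq_nonneg _) (by simp))
          _ ≤ _ := h1
          _ ≤ t ^ lam := Real.rpow_le_rpow (by linarith)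
              ((le_abs_self _).trans (hcoord x hx _)) hlam
    calc volume.real (M ∩ Metric.closedBall 0 t)
        ≤ ∏ i, (2 * a i) := volume_real_le_prod_of_abs_le _ a
          (fun i => Fin.lastCases (by simpa [a] using ht0.le)
            (fun j => by simpa [a] using Real.rpow_nonneg ht0.le lam) i) hbox
      _ = 2 ^ (n + 1) * t ^ (lam * n + 1) := by
          rw [Fin.prod_univ_castSucc, Real.rpow_add ht0, Real.rpow_mul ht0.le, Real.rpow_one,
            Real.rpow_natCast]
          simp only [a, Fin.snoc_castSucc, Fin.snoc_last, Finset.prod_const, Finset.card_univ,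
            Fintype.card_fin]
          ring
      _ ≤ 2 ^ (n + 1) * t ^ p := by gcongr
end
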